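/- (Closability criterion on ℝ^d, 'if' direction) Let ν be a probability measure on ℝ^d that is absolutely continuous with respect to Lebesgue measure with density ρ, and suppose ρ satisfies the Hamza-type condition: for each 1 ≤ i ≤ d and λ^{d-1}-a.e. x with ∫_ℝ ρ_x^{(i)} dλ¹ > 0, ρ_x^{(i)} = 0 λ¹-a.e. on ℝ \ R(ρ_x^{(i)}), where R(ρ_x^{(i)}) := {t : ∫_{t−ε}^{t+ε} 1/ρ_x^{(i)}(s) ds < ∞ for some ε > 0}. Then each partial form E_{ν,i}(u,v) := ∫_{ℝ^d} ∂_i u · ∂_i v dν, defined on C_0^∞(ℝ^d), is closable on L²(ℝ^d, ν). -/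

import Mathlib

open MeasureTheory
open scoped ENNReal

noncomputable section

/-- The `i`-th partial derivative `∂u/∂x_i` on `ℝ^d`. -/
def partialDeriv {d : ℕ} (u : (Fin d → ℝ) → ℝ) (i : Fin d) (x : Fin d → ℝ) : ℝ :=
  fderiv ℝ u x (Pi.single i 1)

/-- The one-dimensional section `ρ_x^{(i)}(s) = ρ(x_1,…,x_{i−1},s,x_{i+1},…,x_d)`
of a density along the `i`-th coordinate through the point `x`. -/
def section' {d : ℕ} (ρ : (Fin d → ℝ) → ℝ) (i : Fin d) (x : Fin d → ℝ) (s : ℝ) : ℝ :=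
  ρ (Function.update x i s)

/-- The set `R(ρ_x^{(i)}) = {t : ∫_{t−ε}^{t+ε} 1/ρ_x^{(i)}(s) ds < ∞ for some ε > 0}`
(with `1/0 = ∞`). -/
def hamzaSet (f : ℝ → ℝ) : Set ℝ :=
  {t : ℝ | ∃ ε > 0, ∫⁻ s in Set.Ioo (t - ε) (t + ε), (ENNReal.ofReal (f s))⁻¹ < ∞}

/-- Weighted Cauchy-Schwarz inequality. -/
theorem cs_weight (w f : ℝ → ℝ≥0∞) (hw : Measurable w) (hwt : ∀ s, w s ≠ ∞)
    (hf : Measurable f) (I : Set ℝ) (hI : ∫⁻ s in I, (w s)⁻¹ < ∞) :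
    ∫⁻ s in I, f s ≤ (∫⁻ s, f s ^ 2 * w s) ^ (1 / 2 : ℝ) * (∫⁻ s in I, (w s)⁻¹) ^ (1 / 2 : ℝ) := by
  have hae : ∀ᵐ s ∂(volume.restrict I), (w s)⁻¹ < ∞ :=
    ae_lt_top hw.inv hI.ne
  have h1 : ∫⁻ s in I, f s
      = ∫⁻ s in I, ((fun s => f s * w s ^ (1 / 2 : ℝ)) * (fun s => (w s)⁻¹ ^ (1 / 2 : ℝ))) s := by
    refine lintegral_congr_ae ?_
    filter_upwards [hae] with s hs
    have h0 : w s ≠ 0 := by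
      intro h
      simp [h] at hs
    simp only [Pi.mul_apply]
    rw [mul_assoc, ← ENNReal.mul_rpow_of_nonneg _ _ (by norm_num), ENNReal.mul_inv_cancel h0 (hwt s)]
    simp
  have h2 := ENNReal.lintegral_mul_le_Lp_mul_Lq (volume.restrict I) (p := 2) (q := 2)
    Real.HolderConjugate.two_two
    (f := fun s => f s * w s ^ (1 / 2 : ℝ)) (g := fun s => (w s)⁻¹ ^ (1 / 2 : ℝ))
    (by fun_prop) (by fun_prop)
  rw [h1]
  refine h2.trans ?_
  have e1 : ∀ s, (f s * w s ^ (1 / 2 : ℝ)) ^ (2 : ℝ) = f s ^ 2 * w s := by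
    intro s
    rw [ENNReal.mul_rpow_of_nonneg _ _ (by norm_num), ← ENNReal.rpow_mul]
    norm_num
  have e2 : ∀ s, ((w s)⁻¹ ^ (1 / 2 : ℝ)) ^ (2 : ℝ) = (w s)⁻¹ := by
    intro s
    rw [← ENNReal.rpow_mul]
    norm_num
  simp only [e1, e2]
  gcongr
  exact Measure.restrict_le_self

theorem cs_tendsto (w : ℝ → ℝ≥0∞) (f : ℕ → ℝ → ℝ≥0∞) (hw : Measurable w) (hwt : ∀ s, w s ≠ ∞)
    (hf : ∀ n, Measurable (f n)) (I : Set ℝ) (hI : ∫⁻ s in I, (w s)⁻¹ < ∞)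
    (h : Filter.Tendsto (fun n => ∫⁻ s, f n s ^ 2 * w s) Filter.atTop (nhds 0)) :
    Filter.Tendsto (fun n => ∫⁻ s in I, f n s) Filter.atTop (nhds 0) := by
  have h1 : Filter.Tendsto (fun n => (∫⁻ s, f n s ^ 2 * w s) ^ (1 / 2 : ℝ) *
      (∫⁻ s in I, (w s)⁻¹) ^ (1 / 2 : ℝ)) Filter.atTop (nhds 0) := by
    have h2 : Filter.Tendsto (fun n => (∫⁻ s, f n s ^ 2 * w s) ^ (1 / 2 : ℝ))
        Filter.atTop (nhds 0) := by
      have := (ENNReal.continuous_rpow_const (y := (1 / 2 : ℝ))).tendsto 0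
      rw [ENNReal.zero_rpow_of_pos (by norm_num)] at this
      exact this.comp h
    have h3 := ENNReal.Tendsto.mul_const (b := (∫⁻ s in I, (w s)⁻¹) ^ (1 / 2 : ℝ)) h2
      (Or.inr (ENNReal.rpow_ne_top_of_nonneg (by norm_num) hI.ne))
    simpa using h3
  exact tendsto_of_tendsto_of_tendsto_of_le_of_le tendsto_const_nhds h1 (fun _ => zero_le)
    (fun n => cs_weight w (f n) hw hwt (hf n) I hI)

theorem lintegral_mul_supp_le (φ f : ℝ → ℝ) (I : Set ℝ) (hI : MeasurableSet I) (C : ℝ)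
    (hC : ∀ s, ‖φ s‖ ≤ C) (h0 : ∀ s, s ∉ I → φ s = 0) :
    ∫⁻ s, ‖φ s * f s‖ₑ ≤ ENNReal.ofReal C * ∫⁻ s in I, ‖f s‖ₑ := by
  rw [← lintegral_const_mul' _ _ ENNReal.ofReal_ne_top, ← lintegral_indicator hI]
  refine lintegral_mono fun s => ?_
  by_cases hs : s ∈ I
  · simp only [hs, Set.indicator_of_mem, enorm_mul]
    gcongr
    rw [← ofReal_norm]
    exact ENNReal.ofReal_le_ofReal (hC s)
  · simp [hs, h0 s hs]

/-- One-dimensional local step. -/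
theorem local_zero (w : ℝ → ℝ≥0∞) (hw : Measurable w) (hwt : ∀ s, w s ≠ ∞)
    (v v' : ℕ → ℝ → ℝ) (g : ℝ → ℝ) (hg : Measurable g)
    (hv : ∀ n s, HasDerivAt (v n) (v' n s) s) (hv' : ∀ n, Continuous (v' n))
    (h1 : Filter.Tendsto (fun n => ∫⁻ s, ‖v n s‖ₑ ^ 2 * w s) Filter.atTop (nhds 0))
    (h2 : Filter.Tendsto (fun n => ∫⁻ s, ‖v' n s - g s‖ₑ ^ 2 * w s) Filter.atTop (nhds 0))
    (a b : ℝ) (hI : ∫⁻ s in Set.Ioo a b, (w s)⁻¹ < ∞) :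
    ∀ᵐ s ∂(volume : Measure ℝ), s ∈ Set.Ioo a b → g s = 0 := by
  have hvc : ∀ n, Continuous (v n) := fun n =>
    continuous_iff_continuousAt.2 fun s => (hv n s).continuousAt
  have k1 := cs_tendsto w (fun n s => ‖v n s‖ₑ) hw hwt
    (fun n => (hvc n).measurable.enorm) _ hI h1
  have k2 := cs_tendsto w (fun n s => ‖v' n s - g s‖ₑ) hw hwt
    (fun n => ((hv' n).measurable.sub hg).enorm) _ hI h2
  have hgI : IntegrableOn g (Set.Ioo a b) := by
    obtain ⟨n, hn⟩ := ((tendsto_order.1 k2).2 1 one_pos).exists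
    have i1 : IntegrableOn (fun s => v' n s - g s) (Set.Ioo a b) :=
      ⟨((hv' n).measurable.sub hg).aestronglyMeasurable, hn.trans ENNReal.one_lt_top⟩
    have i2 : IntegrableOn (v' n) (Set.Ioo a b) :=
      ((hv' n).continuousOn.integrableOn_Icc (a := a) (b := b)).mono_set Set.Ioo_subset_Icc_self
    have i3 := i2.sub i1
    refine i3.congr (Filter.Eventually.of_forall fun s => ?_)
    simp
  refine isOpen_Ioo.ae_eq_zero_of_integral_contDiff_smul_eq_zero hgI.locallyIntegrableOn ?_
  intro φ hφ hφc hφs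
  have hφ0 : ∀ s, s ∉ Set.Ioo a b → φ s = 0 := fun s hs =>
    image_eq_zero_of_notMem_tsupport fun h => hs (hφs h)
  have hdφ : Continuous (deriv φ) := hφ.continuous_deriv (by simp)
  have hdφc : HasCompactSupport (deriv φ) := hφc.deriv
  have hdφ0 : ∀ s, s ∉ Set.Ioo a b → deriv φ s = 0 := fun s hs =>
    image_eq_zero_of_notMem_tsupport fun h => hs (hφs (tsupport_deriv_subset h))
  obtain ⟨C, hC⟩ := hφc.exists_bound_of_continuous hφ.continuous
  obtain ⟨D, hD⟩ := hdφc.exists_bound_of_continuous hdφ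
  have ig : Integrable (fun s => φ s * g s) := by
    have : IntegrableOn (fun s => φ s * g s) (Set.Ioo a b) :=
      hgI.bdd_mul (c := C) hφ.continuous.aestronglyMeasurable
        (Filter.Eventually.of_forall hC)
    exact (integrableOn_iff_integrable_of_support_subset (fun s hs => by
      by_contra hh
      exact hs (by simp [hφ0 s hh]))).1 this
  have key : ∀ n, ‖∫ s, φ s • g s‖ₑ ≤ ENNReal.ofReal C * (∫⁻ s in Set.Ioo a b, ‖v' n s - g s‖ₑ)
      + ENNReal.ofReal D * ∫⁻ s in Set.Ioo a b, ‖v n s‖ₑ := by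
    intro n
    have ip1 : Integrable (fun s => φ s * v' n s) :=
      (hφ.continuous.mul (hv' n)).integrable_of_hasCompactSupport hφc.mul_right
    have ip2 : Integrable (fun s => deriv φ s * v n s) :=
      (hdφ.mul (hvc n)).integrable_of_hasCompactSupport hdφc.mul_right
    have ip3 : Integrable (fun s => φ s * v n s) :=
      (hφ.continuous.mul (hvc n)).integrable_of_hasCompactSupport hφc.mul_right
    have ibp : ∫ s, φ s * v' n s = - ∫ s, deriv φ s * v n s :=
      integral_mul_deriv_eq_deriv_mul_of_integrable
        (fun s _ => ((hφ.differentiable (by simp)) s).hasDerivAt) (fun s _ => hv n s) ip1 ip2 ip3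
    have e : ∫ s, φ s • g s = - (∫ s, φ s * (v' n s - g s)) - ∫ s, deriv φ s * v n s := by
      have : ∫ s, φ s * (v' n s - g s) = (∫ s, φ s * v' n s) - ∫ s, φ s * g s := by
        rw [← integral_sub ip1 ig]
        simp only [mul_sub]
      rw [this, ibp]
      simp
    rw [e]
    refine (enorm_sub_le).trans ?_
    rw [enorm_neg]
    exact add_le_add
      ((enorm_integral_le_lintegral_enorm _).trans
        (lintegral_mul_supp_le φ _ _ measurableSet_Ioo C hC hφ0))
      ((enorm_integral_le_lintegral_enorm _).trans
        (lintegral_mul_supp_le (deriv φ) _ _ measurableSet_Ioo D hD hdφ0))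
  have lim := (ENNReal.Tendsto.const_mul (a := ENNReal.ofReal C) k2
    (Or.inr ENNReal.ofReal_ne_top)).add (ENNReal.Tendsto.const_mul (a := ENNReal.ofReal D) k1
    (Or.inr ENNReal.ofReal_ne_top))
  have := ge_of_tendsto' lim key
  simpa using this

/-- One-dimensional step. -/
theorem line_zero (r : ℝ → ℝ) (hr : Measurable r)
    (v v' : ℕ → ℝ → ℝ) (g : ℝ → ℝ) (hg : Measurable g)
    (hv : ∀ n s, HasDerivAt (v n) (v' n s) s) (hv' : ∀ n, Continuous (v' n))
    (h1 : Filter.Tendsto (fun n => ∫⁻ s, ‖v n s‖ₑ ^ 2 * ENNReal.ofReal (r s))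
      Filter.atTop (nhds 0))
    (h2 : Filter.Tendsto (fun n => ∫⁻ s, ‖v' n s - g s‖ₑ ^ 2 * ENNReal.ofReal (r s))
      Filter.atTop (nhds 0)) :
    ∀ᵐ s ∂(volume : Measure ℝ), s ∈ hamzaSet r → g s = 0 := by
  rw [ae_iff]
  refine measure_null_of_locally_null _ ?_
  intro t ht
  simp only [Set.mem_ofPred_eq, Classical.not_imp] at ht
  obtain ⟨⟨ε, hε, hI⟩, -⟩ := ht
  have := local_zero (fun s => ENNReal.ofReal (r s)) hr.ennreal_ofReal
    (fun _ => ENNReal.ofReal_ne_top) v v' g hg hv hv' h1 h2 (t - ε) (t + ε) hI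
  rw [ae_iff] at this
  refine ⟨_ ∩ Set.Ioo (t - ε) (t + ε), Filter.inter_mem self_mem_nhdsWithin
    (mem_nhdsWithin_of_mem_nhds (Ioo_mem_nhds (by linarith) (by linarith))), ?_⟩
  refine measure_mono_null ?_ this
  rintro s ⟨hs, hs'⟩
  simp only [Set.mem_ofPred_eq, Classical.not_imp] at hs ⊢
  exact ⟨hs', hs.2⟩

/-- Convergence to zero of integrals gives a.e. convergence to zero along a subsequence. -/
theorem exists_ae_subseq {α : Type*} [MeasurableSpace α] (μ : Measure α) (H : ℕ → α → ℝ≥0∞)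
    (hH : ∀ n, Measurable (H n))
    (h : Filter.Tendsto (fun n => ∫⁻ y, H n y ∂μ) Filter.atTop (nhds 0)) :
    ∃ φ : ℕ → ℕ, ∀ᵐ y ∂μ, Filter.Tendsto (fun k => H (φ k) y) Filter.atTop (nhds 0) := by
  have : ∀ k : ℕ, ∃ n, ∫⁻ y, H n y ∂μ < (2⁻¹ : ℝ≥0∞) ^ k := fun k =>
    ((tendsto_order.1 h).2 _ (ENNReal.pow_pos (by simp) k)).exists
  choose φ hφ using this
  refine ⟨φ, ?_⟩
  have hs : ∫⁻ y, ∑' k, H (φ k) y ∂μ ≠ ∞ := by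
    rw [lintegral_tsum fun k => (hH _).aemeasurable]
    refine ne_top_of_le_ne_top ?_ (ENNReal.tsum_le_tsum fun k => (hφ k).le)
    rw [ENNReal.tsum_geometric]
    simp
  filter_upwards [ae_lt_top (Measurable.tsum fun k => hH (φ k)) hs] with y hy
  exact ENNReal.tendsto_atTop_zero_of_tsum_ne_top hy.ne

theorem norm_toLp_sq {α : Type*} [MeasurableSpace α] {μ : Measure α} {f : α → ℝ}
    (hf : MemLp f 2 μ) : ‖hf.toLp f‖ ^ 2 = ∫ x, f x ^ 2 ∂μ := by
  rw [← real_inner_self_eq_norm_sq, L2.inner_def]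
  refine integral_congr_ae ?_
  filter_upwards [hf.coeFn_toLp] with x hx
  rw [hx]
  simp [sq]

theorem lintegral_enorm_sq {α : Type*} [MeasurableSpace α] {μ : Measure α} {f : α → ℝ}
    (hf : MemLp f 2 μ) : ∫⁻ x, ‖f x‖ₑ ^ 2 ∂μ = ENNReal.ofReal (∫ x, f x ^ 2 ∂μ) := by
  rw [ofReal_integral_eq_lintegral_ofReal hf.integrable_sq
    (Filter.Eventually.of_forall fun x => sq_nonneg _)]
  refine lintegral_congr fun x => ?_
  rw [← ofReal_norm, ← ENNReal.ofReal_pow (norm_nonneg _)]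
  simp

/-- Fubini in the `i`-th coordinate. -/
theorem lintegral_fubini {d : ℕ} (i : Fin (d + 1)) (F : (Fin (d + 1) → ℝ) → ℝ≥0∞)
    (hF : Measurable F) :
    ∫⁻ x, F x = ∫⁻ y : Fin d → ℝ, ∫⁻ s : ℝ, F (i.insertNth s y) := by
  have hmp := (volume_preserving_piFinSuccAbove (fun _ : Fin (d + 1) => ℝ) i).symm
  rw [← hmp.lintegral_comp hF]
  have := lintegral_prod_symm (μ := (volume : Measure ℝ)) (ν := (volume : Measure (Fin d → ℝ)))
    (fun p => F ((MeasurableEquiv.piFinSuccAbove (fun _ : Fin (d + 1) => ℝ) i).symm p))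
    (hF.comp (MeasurableEquiv.measurable _)).aemeasurable
  exact this

theorem measurable_insertNth_pair {d : ℕ} (i : Fin (d + 1)) :
    Measurable (fun p : ℝ × (Fin d → ℝ) => (i.insertNth p.1 p.2 : Fin (d + 1) → ℝ)) :=
  (MeasurableEquiv.piFinSuccAbove (fun _ : Fin (d + 1) => ℝ) i).symm.measurable

theorem measurable_insertNth_left {d : ℕ} (i : Fin (d + 1)) (y : Fin d → ℝ) :
    Measurable (fun s : ℝ => (i.insertNth s y : Fin (d + 1) → ℝ)) :=
  (measurable_insertNth_pair i).comp (measurable_id.prodMk measurable_const)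

theorem update_insertNth' {d : ℕ} (i : Fin (d + 1)) (y : Fin d → ℝ) (t s : ℝ) :
    Function.update (i.insertNth t y : Fin (d + 1) → ℝ) i s = i.insertNth s y := by
  simp

theorem hasDerivAt_insertNth {d : ℕ} (i : Fin (d + 1)) (y : Fin d → ℝ) (s : ℝ) :
    HasDerivAt (fun s : ℝ => (i.insertNth s y : Fin (d + 1) → ℝ)) (Pi.single i 1) s := by
  have := hasDerivAt_update (𝕜 := ℝ) (i.insertNth 0 y : Fin (d + 1) → ℝ) i s
  have e : (fun s : ℝ => (i.insertNth s y : Fin (d + 1) → ℝ))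
      = Function.update (i.insertNth 0 y : Fin (d + 1) → ℝ) i := by
    funext s
    exact (update_insertNth' i y 0 s).symm
  rw [e]
  exact this

/-- a.e. statements about sections, transferred to `ℝ^{d}`. -/
theorem ae_section {d : ℕ} (i : Fin (d + 1)) (ρ : (Fin (d + 1) → ℝ) → ℝ) (P : (ℝ → ℝ) → Prop)
    (h : ∀ᵐ x ∂(volume : Measure (Fin (d + 1) → ℝ)), P (section' ρ i x)) :
    ∀ᵐ y ∂(volume : Measure (Fin d → ℝ)), P (fun s => ρ (i.insertNth s y)) := by
  have hmp := (volume_preserving_piFinSuccAbove (fun _ : Fin (d + 1) => ℝ) i).symm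
  have h1 := hmp.quasiMeasurePreserving.ae h
  have h2 := Measure.ae_ae_of_ae_prod (μ := (volume : Measure ℝ))
    (ν := (volume : Measure (Fin d → ℝ))) h1
  obtain ⟨t, ht⟩ := h2.exists
  filter_upwards [ht] with y hy
  have e : section' ρ i ((MeasurableEquiv.piFinSuccAbove (fun _ : Fin (d + 1) => ℝ) i).symm (t, y))
      = fun s => ρ (i.insertNth s y) := by
    funext s
    exact congrArg ρ (update_insertNth' i y t s)
  rwa [e] at hy

/-- closability criterion on `ℝ^d`, 'if' direction: let `ν = ρ·λ^d` be
a probability measure on `ℝ^d` whose density `ρ` satisfies the Hamza-type condition: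
for each `i` and a.e. section with `∫ ρ_x^{(i)} dλ¹ > 0`, `ρ_x^{(i)} = 0` `λ¹`-a.e.
outside `R(ρ_x^{(i)})`.  Then each partial form
`E_{ν,i}(u,v) = ∫ ∂_i u ∂_i v dν` on `C_0^∞(ℝ^d)` is closable on `L²(ℝ^d,ν)`: if
`u_n ∈ C_0^∞`, `u_n → 0` in `L²(ν)` and `E_{ν,i}(u_n−u_m,u_n−u_m) → 0`, then
`E_{ν,i}(u_n,u_n) → 0`. -/
theorem hamza_closability {d : ℕ} (ρ : (Fin d → ℝ) → ℝ)
    (hρm : Measurable ρ) (hρ0 : ∀ x, 0 ≤ ρ x)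
    (ν : Measure (Fin d → ℝ))
    (hν : ν = (volume : Measure (Fin d → ℝ)).withDensity fun x => ENNReal.ofReal (ρ x))
    (hνp : IsProbabilityMeasure ν)
    (hamza : ∀ i : Fin d, ∀ᵐ x ∂(volume : Measure (Fin d → ℝ)),
      (0 < ∫⁻ s, ENNReal.ofReal (section' ρ i x s) ∂(volume : Measure ℝ)) →
      ∀ᵐ s ∂(volume : Measure ℝ),
        s ∉ hamzaSet (section' ρ i x) → section' ρ i x s = 0)
    (i : Fin d) (u : ℕ → (Fin d → ℝ) → ℝ)
    (hu : ∀ n, ContDiff ℝ (⊤ : ℕ∞) (u n) ∧ HasCompactSupport (u n))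
    (hL2 : Filter.Tendsto (fun n => ∫ x, (u n x) ^ 2 ∂ν) Filter.atTop (nhds 0))
    (hCauchy : ∀ ε > 0, ∃ N, ∀ n ≥ N, ∀ m ≥ N,
      ∫ x, (partialDeriv (u n) i x - partialDeriv (u m) i x) ^ 2 ∂ν < ε) :
    Filter.Tendsto (fun n => ∫ x, (partialDeriv (u n) i x) ^ 2 ∂ν)
      Filter.atTop (nhds 0) := by
  obtain _ | d := d
  · exact i.elim0
  have hρe : Measurable fun x => ENNReal.ofReal (ρ x) := hρm.ennreal_ofReal
  have hpc : ∀ n, Continuous (partialDeriv (u n) i) := fun n =>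
    ((hu n).1.continuous_fderiv (by simp)).clm_apply continuous_const
  have hpk : ∀ n, HasCompactSupport (partialDeriv (u n) i) := fun n =>
    ((hu n).2.fderiv ℝ).comp_left (g := fun L : (Fin (d + 1) → ℝ) →L[ℝ] ℝ => L (Pi.single i 1))
      (by simp)
  have hum : ∀ n, MemLp (u n) 2 ν := fun n =>
    (hu n).1.continuous.memLp_of_hasCompactSupport (hu n).2
  have hpm : ∀ n, MemLp (partialDeriv (u n) i) 2 ν := fun n =>
    (hpc n).memLp_of_hasCompactSupport (hpk n)
  have hcs : CauchySeq fun n => (hpm n).toLp (partialDeriv (u n) i) := by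
    rw [Metric.cauchySeq_iff]
    intro ε hε
    obtain ⟨N, hN⟩ := hCauchy (ε ^ 2) (by positivity)
    refine ⟨N, fun m hm n hn => ?_⟩
    have := hN m hm n hn
    rw [dist_eq_norm, ← MemLp.toLp_sub]
    have e := norm_toLp_sq ((hpm m).sub (hpm n))
    simp only [Pi.sub_apply] at e
    rw [← e] at this
    exact lt_of_pow_lt_pow_left₀ 2 hε.le this
  obtain ⟨G, hG⟩ := cauchySeq_tendsto_of_complete hcs
  obtain ⟨g, hgs, hgG⟩ := Lp.aestronglyMeasurable G
  have hgm : Measurable g := hgs.measurable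
  have hgL : MemLp g 2 ν := (memLp_congr_ae hgG).1 (Lp.memLp G)
  have hGg : G = hgL.toLp g := by
    rw [← Lp.toLp_coeFn G (Lp.memLp G)]
    exact (MemLp.toLp_eq_toLp_iff _ _).2 hgG
  have hB : Filter.Tendsto (fun n => ∫⁻ x, ‖partialDeriv (u n) i x - g x‖ₑ ^ 2 ∂ν)
      Filter.atTop (nhds 0) := by
    have e : ∀ n, ∫⁻ x, ‖partialDeriv (u n) i x - g x‖ₑ ^ 2 ∂ν
        = ENNReal.ofReal (‖(hpm n).toLp (partialDeriv (u n) i) - G‖ ^ 2) := by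
      intro n
      rw [hGg, ← MemLp.toLp_sub, norm_toLp_sq]
      exact lintegral_enorm_sq ((hpm n).sub hgL)
    simp only [e]
    have := (ENNReal.continuous_ofReal.tendsto _).comp
      ((tendsto_iff_norm_sub_tendsto_zero.1 hG).pow 2)
    rw [zero_pow two_ne_zero, ENNReal.ofReal_zero] at this
    exact this
  have hA : Filter.Tendsto (fun n => ∫⁻ x, ‖u n x‖ₑ ^ 2 ∂ν) Filter.atTop (nhds 0) := by
    simp only [fun n => lintegral_enorm_sq (hum n)]
    have := (ENNReal.continuous_ofReal.tendsto _).comp hL2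
    rw [ENNReal.ofReal_zero] at this
    exact this
  have hum' : ∀ n, Measurable (u n) := fun n => (hu n).1.continuous.measurable
  have hpm' : ∀ n, Measurable (partialDeriv (u n) i) := fun n => (hpc n).measurable
  have hFm : ∀ n, Measurable fun x =>
      (‖u n x‖ₑ ^ 2 + ‖partialDeriv (u n) i x - g x‖ₑ ^ 2) * ENNReal.ofReal (ρ x) := fun n =>
    (((hum' n).enorm.pow_const 2).add (((hpm' n).sub hgm).enorm.pow_const 2)).mul hρe
  have hH : Filter.Tendsto (fun n => ∫⁻ y : Fin d → ℝ, ∫⁻ s : ℝ,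
      (‖u n (i.insertNth s y)‖ₑ ^ 2
        + ‖partialDeriv (u n) i (i.insertNth s y) - g (i.insertNth s y)‖ₑ ^ 2)
        * ENNReal.ofReal (ρ (i.insertNth s y))) Filter.atTop (nhds 0) := by
    have e : ∀ n, (∫⁻ y : Fin d → ℝ, ∫⁻ s : ℝ,
      (‖u n (i.insertNth s y)‖ₑ ^ 2
        + ‖partialDeriv (u n) i (i.insertNth s y) - g (i.insertNth s y)‖ₑ ^ 2)
        * ENNReal.ofReal (ρ (i.insertNth s y)))
        = (∫⁻ x, ‖u n x‖ₑ ^ 2 ∂ν) + ∫⁻ x, ‖partialDeriv (u n) i x - g x‖ₑ ^ 2 ∂ν := by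
      intro n
      rw [← lintegral_fubini i _ (hFm n), ← lintegral_add_left ((hum' n).enorm.pow_const 2), hν,
        lintegral_withDensity_eq_lintegral_mul _ hρe
          (g := fun x => ‖u n x‖ₑ ^ 2 + ‖partialDeriv (u n) i x - g x‖ₑ ^ 2)
          (((hum' n).enorm.pow_const 2).add (((hpm' n).sub hgm).enorm.pow_const 2))]
      refine lintegral_congr fun x => ?_
      simp [mul_comm]
    simp only [e]
    simpa using hA.add hB
  obtain ⟨φ, hφ⟩ := exists_ae_subseq volume _ (fun n => Measurable.lintegral_prod_left'
    ((hFm n).comp (measurable_insertNth_pair i))) hH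
  have hz := ae_section i ρ (fun r => (0 < ∫⁻ s, ENNReal.ofReal (r s)) →
      ∀ᵐ s ∂(volume : Measure ℝ), s ∉ hamzaSet r → r s = 0) (hamza i)
  have hfin : ∀ᵐ y ∂(volume : Measure (Fin d → ℝ)),
      ∫⁻ s : ℝ, ‖g (i.insertNth s y)‖ₑ ^ 2 * ENNReal.ofReal (ρ (i.insertNth s y)) = 0 := by
    filter_upwards [hφ, hz] with y hy hzy
    have hins := measurable_insertNth_left i y
    have hrm : Measurable fun s => ρ (i.insertNth s y) := hρm.comp hins
    rcases (zero_le (a := ∫⁻ s, ENNReal.ofReal (ρ (i.insertNth s y)))).eq_or_lt with h0 | h0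
    · have h0' := (lintegral_eq_zero_iff hrm.ennreal_ofReal).1 h0.symm
      refine (lintegral_eq_zero_iff (((hgm.comp hins).enorm.pow_const 2).mul
        hrm.ennreal_ofReal)).2 ?_
      filter_upwards [h0'] with s hs
      simp only [Pi.zero_apply, Pi.mul_apply] at hs ⊢
      rw [hs, mul_zero]
    · have h1 := hzy h0
      have h2 := line_zero (fun s => ρ (i.insertNth s y)) hrm
        (fun k s => u (φ k) (i.insertNth s y))
        (fun k s => partialDeriv (u (φ k)) i (i.insertNth s y))
        (fun s => g (i.insertNth s y)) (hgm.comp hins)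
        (fun k s => (((hu (φ k)).1.differentiable (by simp)) _).hasFDerivAt.comp_hasDerivAt s
          (hasDerivAt_insertNth i y s))
        (fun k => (hpc (φ k)).comp (continuous_iff_continuousAt.2
          fun s => (hasDerivAt_insertNth i y s).continuousAt))
        (tendsto_of_tendsto_of_tendsto_of_le_of_le tendsto_const_nhds hy (fun _ => zero_le)
          (fun k => lintegral_mono fun s => by
            exact mul_le_mul_left le_self_add _))
        (tendsto_of_tendsto_of_tendsto_of_le_of_le tendsto_const_nhds hy (fun _ => zero_le)
          (fun k => lintegral_mono fun s => by
            exact mul_le_mul_left le_add_self _))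
      refine (lintegral_eq_zero_iff (((hgm.comp hins).enorm.pow_const 2).mul
        hrm.ennreal_ofReal)).2 ?_
      filter_upwards [h1, h2] with s hs1 hs2
      by_cases hs : s ∈ hamzaSet fun s => ρ (i.insertNth s y)
      · simp [hs2 hs]
      · simp [hs1 hs]
  have hg0 : ∫⁻ x, ‖g x‖ₑ ^ 2 ∂ν = 0 := by
    rw [hν, lintegral_withDensity_eq_lintegral_mul _ hρe (hgm.enorm.pow_const 2)]
    have := lintegral_fubini i (fun x => ‖g x‖ₑ ^ 2 * ENNReal.ofReal (ρ x))
      ((hgm.enorm.pow_const 2).mul hρe)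
    rw [lintegral_congr_ae hfin, lintegral_zero] at this
    rw [← this]
    exact lintegral_congr fun x => mul_comm (ENNReal.ofReal (ρ x)) (‖g x‖ₑ ^ 2)
  have hGn : G = 0 := by
    rw [lintegral_enorm_sq hgL, ← norm_toLp_sq hgL, ← hGg, ENNReal.ofReal_eq_zero] at hg0
    have := le_antisymm hg0 (sq_nonneg _)
    simpa using this
  rw [hGn] at hG
  have := (tendsto_zero_iff_norm_tendsto_zero.1 hG).pow 2
  simp only [norm_toLp_sq] at this
  rw [zero_pow two_ne_zero] at this
  exact this
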